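/- arXiv:2605.06278 — 2 statements merged into one kernel-verified Lean document; each statement's English description precedes it below -/
import Mathlib

section
/- Pruning guarantee (second part of Proposition 1): let h be a finite set of learners, let H be a set of learners, and let μ be a dual vector that is dual feasible for h and whose dual value equals ℓ(h). If the reduced cost c_μ(λ) is nonnegative for every λ ∈ H, then ℓ(h') ≥ ℓ(h) for every finite set h' of learners with h' ⊆ H; in particular, if moreover h ⊆ H, then ℓ(h ∪ {λ}) = ℓ(h) for every λ ∈ H, i.e., no learner in H is improving. -/
open Finset
open scoped Classical

noncomputable section

variable {X Y : Type*}

/-- `w` is primal feasible for the ensemble `h`: nonnegative weights whose aggregated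
margins are at least `1` on every sample–alternative-label pair. -/
def PrimalFeasible (Xo : Finset X) (Yf : Finset Y) (yo : X → Y)
    (h : Finset (X → Y → ℝ)) (w : (X → Y → ℝ) → ℝ) : Prop :=
  (∀ l ∈ h, 0 ≤ w l) ∧
  ∀ x ∈ Xo, ∀ y ∈ Yf, y ≠ yo x → 1 ≤ ∑ l ∈ h, w l * (l x (yo x) - l x y)

/-- `μ` is a dual vector: nonnegative on every pair `(x, y)` with `x ∈ X°`, `y ∈ Y`, `y ≠ y°(x)`. -/
def DualVector (Xo : Finset X) (Yf : Finset Y) (yo : X → Y) (μ : X → Y → ℝ) : Prop :=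
  ∀ x ∈ Xo, ∀ y ∈ Yf, y ≠ yo x → 0 ≤ μ x y

/-- `μ` is dual feasible for the ensemble `h`. -/
def DualFeasible (Xo : Finset X) (Yf : Finset Y) (yo : X → Y)
    (h : Finset (X → Y → ℝ)) (μ : X → Y → ℝ) : Prop :=
  DualVector Xo Yf yo μ ∧
  ∀ l ∈ h, ∑ x ∈ Xo, ∑ y ∈ Yf.filter (· ≠ yo x), μ x y * (l x (yo x) - l x y) ≤ 1

/-- Dual objective value of `μ`. -/
def dualValue (Xo : Finset X) (Yf : Finset Y) (yo : X → Y) (μ : X → Y → ℝ) : ℝ :=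
  ∑ x ∈ Xo, ∑ y ∈ Yf.filter (· ≠ yo x), μ x y

/-- Reduced cost of the learner `l` with respect to the dual vector `μ`. -/
def reducedCost (Xo : Finset X) (Yf : Finset Y) (yo : X → Y)
    (μ : X → Y → ℝ) (l : X → Y → ℝ) : ℝ :=
  1 - ∑ x ∈ Xo, ∑ y ∈ Yf.filter (· ≠ yo x), μ x y * (l x (yo x) - l x y)

/-- Restricted value `ℓ(h)`: infimum (in the extended reals) of the primal values of
primal feasible weight vectors for `h`; it is `⊤` when no feasible vector exists. -/
def restrictedValue (Xo : Finset X) (Yf : Finset Y) (yo : X → Y)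
    (h : Finset (X → Y → ℝ)) : EReal :=
  sInf {v : EReal | ∃ w : (X → Y → ℝ) → ℝ,
    PrimalFeasible Xo Yf yo h w ∧ v = ((∑ l ∈ h, w l : ℝ) : EReal)}

end

/-- Weak duality: the value of a dual feasible vector bounds the restricted value from below. -/
theorem dualValue_le_restrictedValue {X Y : Type*} {Xo : Finset X} {Yf : Finset Y} {yo : X → Y}
    {h : Finset (X → Y → ℝ)} {μ : X → Y → ℝ} (hμ : DualFeasible Xo Yf yo h μ) :
    ((dualValue Xo Yf yo μ : ℝ) : EReal) ≤ restrictedValue Xo Yf yo h := by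
  refine le_sInf ?_
  rintro _ ⟨w, ⟨hw, hm⟩, rfl⟩
  rw [EReal.coe_le_coe_iff]
  calc dualValue Xo Yf yo μ
      ≤ ∑ x ∈ Xo, ∑ y ∈ Yf.filter (· ≠ yo x),
          μ x y * ∑ l ∈ h, w l * (l x (yo x) - l x y) := by
        refine sum_le_sum fun x hx => sum_le_sum fun y hy => ?_
        obtain ⟨hy, hne⟩ := mem_filter.1 hy
        exact le_mul_of_one_le_right (hμ.1 x hx y hy hne) (hm x hx y hy hne)
    _ = ∑ x ∈ Xo, ∑ l ∈ h, ∑ y ∈ Yf.filter (· ≠ yo x),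
          w l * (μ x y * (l x (yo x) - l x y)) := by
        refine sum_congr rfl fun x _ => ?_
        rw [sum_comm]
        refine sum_congr rfl fun y _ => ?_
        rw [mul_sum]
        exact sum_congr rfl fun l _ => mul_left_comm _ _ _
    _ = ∑ l ∈ h, w l * ∑ x ∈ Xo, ∑ y ∈ Yf.filter (· ≠ yo x),
          μ x y * (l x (yo x) - l x y) := by
        rw [sum_comm]
        simp only [mul_sum]
    _ ≤ ∑ l ∈ h, w l :=
        sum_le_sum fun l hl => mul_le_of_le_one_right (hw l hl) (hμ.2 l hl)

/-- Enlarging the ensemble does not increase the restricted value. -/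
theorem restrictedValue_anti {X Y : Type*} {Xo : Finset X} {Yf : Finset Y} {yo : X → Y}
    {h h' : Finset (X → Y → ℝ)} (hh : h ⊆ h') :
    restrictedValue Xo Yf yo h' ≤ restrictedValue Xo Yf yo h := by
  refine le_sInf ?_
  rintro _ ⟨w, ⟨hw, hm⟩, rfl⟩
  refine sInf_le ⟨fun l => if l ∈ h then w l else 0, ⟨fun l _ => ?_, fun x hx y hy hne => ?_⟩, ?_⟩
  · dsimp only
    split_ifs with hl
    exacts [hw l hl, le_rfl]
  · simpa only [ite_mul, zero_mul, sum_ite_mem, inter_eq_right.2 hh] using hm x hx y hy hne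
  · simp only [sum_ite_mem, inter_eq_right.2 hh]

/-- **Pruning guarantee** (second part of Proposition 1): if `μ` is dual feasible for `h`
with dual value `ℓ(h)` and every learner in `H` has nonnegative reduced cost, then
`ℓ(h') ≥ ℓ(h)` for every finite `h' ⊆ H`; in particular, if `h ⊆ H` then no learner of `H`
is improving for `h`. -/
theorem pruning_guarantee {X Y : Type*} (Xo : Finset X) (Yf : Finset Y) (yo : X → Y)
    (hXo : Xo.Nonempty) (hYf : 2 ≤ Yf.card) (hyo : ∀ x ∈ Xo, yo x ∈ Yf)
    (H : Set (X → Y → ℝ)) (h : Finset (X → Y → ℝ)) (μ : X → Y → ℝ)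
    (hμ : DualFeasible Xo Yf yo h μ)
    (hval : ((dualValue Xo Yf yo μ : ℝ) : EReal) = restrictedValue Xo Yf yo h)
    (hrc : ∀ l ∈ H, 0 ≤ reducedCost Xo Yf yo μ l) :
    (∀ h' : Finset (X → Y → ℝ), ↑h' ⊆ H →
        restrictedValue Xo Yf yo h ≤ restrictedValue Xo Yf yo h') ∧
    (↑h ⊆ H → ∀ l ∈ H,
        restrictedValue Xo Yf yo (insert l h) = restrictedValue Xo Yf yo h) := by
  have lower : ∀ h' : Finset (X → Y → ℝ), ↑h' ⊆ H →
      restrictedValue Xo Yf yo h ≤ restrictedValue Xo Yf yo h' := fun h' hh' =>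
    hval ▸ dualValue_le_restrictedValue ⟨hμ.1, fun l hl => sub_nonneg.1 (hrc l (hh' hl))⟩
  refine ⟨lower, fun hH l hl => (restrictedValue_anti (subset_insert l h)).antisymm (lower _ ?_)⟩
  rw [coe_insert]
  exact Set.insert_subset hl hH
end

section
/- Improvement guarantee (first part of Proposition 1, made precise): let h be a finite set of learners admitting at least one primal feasible weight vector, and let λ* be a learner with λ* ∉ h. Assume (i) every dual vector μ that is dual feasible for h and whose dual value equals ℓ(h) satisfies c_μ(λ*) < 0, and (ii) there exists a dual vector μ' that is dual feasible for h ∪ {λ*} and whose dual value equals ℓ(h ∪ {λ*}). Then ℓ(h ∪ {λ*}) < ℓ(h), i.e., λ* is an improving learner for h. -/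
open Finset
open scoped Classical

/-- Enlarging the ensemble cannot increase the restricted value. -/
theorem restrictedValue_insert_le {X Y : Type*} (Xo : Finset X) (Yf : Finset Y) (yo : X → Y)
    {h : Finset (X → Y → ℝ)} {l₀ : X → Y → ℝ} (hl₀ : l₀ ∉ h) :
    restrictedValue Xo Yf yo (insert l₀ h) ≤ restrictedValue Xo Yf yo h := by
  refine le_sInf ?_
  rintro _ ⟨w, ⟨hw, hmargin⟩, rfl⟩
  have hagree : ∀ l ∈ h, Function.update w l₀ 0 l = w l := fun l hl ↦
    Function.update_of_ne (ne_of_mem_of_not_mem hl hl₀) _ _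
  refine sInf_le ⟨Function.update w l₀ 0, ⟨fun l hl ↦ ?_, fun x hx y hy hne ↦ ?_⟩, ?_⟩
  · rcases Finset.mem_insert.mp hl with rfl | hl
    · simp
    · rw [hagree l hl]
      exact hw l hl
  · rw [Finset.sum_insert hl₀, Function.update_self, zero_mul, zero_add,
      Finset.sum_congr rfl fun l hl ↦ by rw [hagree l hl]]
    exact hmargin x hx y hy hne
  · rw [Finset.sum_insert hl₀, Function.update_self, zero_add, Finset.sum_congr rfl hagree]

/-- **Improvement guarantee** (first part of Proposition 1, made precise): if every
optimal dual solution for `h` gives `λ*` a strictly negative reduced cost, and the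
augmented problem admits an optimal dual solution, then `λ*` is an improving learner. -/
theorem improvement_guarantee {X Y : Type*} (Xo : Finset X) (Yf : Finset Y) (yo : X → Y)
    (hXo : Xo.Nonempty) (hYf : 2 ≤ Yf.card) (hyo : ∀ x ∈ Xo, yo x ∈ Yf)
    (h : Finset (X → Y → ℝ)) (lstar : X → Y → ℝ) (hlstar : lstar ∉ h)
    (hfeas : ∃ w : (X → Y → ℝ) → ℝ, PrimalFeasible Xo Yf yo h w)
    (hi : ∀ μ : X → Y → ℝ, DualFeasible Xo Yf yo h μ →
      ((dualValue Xo Yf yo μ : ℝ) : EReal) = restrictedValue Xo Yf yo h →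
      reducedCost Xo Yf yo μ lstar < 0)
    (hii : ∃ μ' : X → Y → ℝ, DualFeasible Xo Yf yo (insert lstar h) μ' ∧
      ((dualValue Xo Yf yo μ' : ℝ) : EReal) = restrictedValue Xo Yf yo (insert lstar h)) :
    restrictedValue Xo Yf yo (insert lstar h) < restrictedValue Xo Yf yo h := by
  refine lt_of_le_of_ne (restrictedValue_insert_le Xo Yf yo hlstar) fun heq ↦ ?_
  obtain ⟨μ, ⟨hμ, hle⟩, hval⟩ := hii
  have hneg := hi μ ⟨hμ, fun l hl ↦ hle l (Finset.mem_insert_of_mem hl)⟩ (hval.trans heq)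
  have hstar := hle lstar (Finset.mem_insert_self lstar h)
  unfold reducedCost at hneg
  linarith
end
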